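/- The field extension K = ℚ(a,b,c,d,e,f) over its subfield ℚ(s_1, t_1, s_2, t_2, s_3, t_3) generated by the line coordinates of the three Pascal lines ℓ_1, ℓ_2, ℓ_3 has degree exactly 2. -/

import Mathlib

noncomputable section

/-- `K = ℚ(a,b,c,d,e,f)`, the field of rational functions in six variables over ℚ. -/
abbrev RatField : Type := FractionRing (MvPolynomial (Fin 6) ℚ)

/-- The six independent variables `a, b, c, d, e, f` (indexed `0,…,5`) as elements of
`ℚ(a,…,f)`. -/
def var (i : Fin 6) : RatField :=
  algebraMap (MvPolynomial (Fin 6) ℚ) RatField (MvPolynomial.X i)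

/-- The point `[1, p, p²]` of the conic `z1² = z0·z2`, in homogeneous coordinates. -/
def conicPt (p : RatField) : Fin 3 → RatField := ![1, p, p ^ 2]

/-- Cross product of coordinate vectors: the coordinates of the join of two points, or of
the intersection of two lines. -/
def cross (u v : Fin 3 → RatField) : Fin 3 → RatField :=
  ![u 1 * v 2 - u 2 * v 1, u 2 * v 0 - u 0 * v 2, u 0 * v 1 - u 1 * v 0]

/-- The homogeneous coordinate vector of the Pascal line of the array
`[P1 P2 P3; Q1 Q2 Q3]` of points of the conic with parameters `p1, p2, p3, q1, q2, q3`: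
the line through the (collinear) points `P1Q2 ∩ P2Q1`, `P2Q3 ∩ P3Q2`, `P1Q3 ∩ P3Q1`,
computed as the join of the first two of them. -/
def pascalVec (p1 p2 p3 q1 q2 q3 : RatField) : Fin 3 → RatField :=
  cross
    (cross (cross (conicPt p1) (conicPt q2)) (cross (conicPt p2) (conicPt q1)))
    (cross (cross (conicPt p2) (conicPt q3)) (cross (conicPt p3) (conicPt q2)))

/-- The coordinate `s` of a line with coordinates `⟨1, s, t⟩`, i.e. the line
`z0 + s·z1 + t·z2 = 0`. -/
def sCoord (l : Fin 3 → RatField) : RatField := l 1 / l 0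

/-- The coordinate `t` of a line with coordinates `⟨1, s, t⟩`, i.e. the line
`z0 + s·z1 + t·z2 = 0`. -/
def tCoord (l : Fin 3 → RatField) : RatField := l 2 / l 0

/-- The Pascal `ℓ₁` of the array `[A D B; E C F]`. -/
def line1 : Fin 3 → RatField := pascalVec (var 0) (var 3) (var 1) (var 4) (var 2) (var 5)

/-- The Pascal `ℓ₂` of the array `[A C F; E D B]`. -/
def line2 : Fin 3 → RatField := pascalVec (var 0) (var 2) (var 5) (var 4) (var 3) (var 1)

/-- The Pascal `ℓ₃` of the array `[A D F; E C B]`. -/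
def line3 : Fin 3 → RatField := pascalVec (var 0) (var 3) (var 5) (var 4) (var 2) (var 1)

/-- The Pascal `ℓ⋆` of the array `[A B C; F D E]`. -/
def lineStar : Fin 3 → RatField :=
  pascalVec (var 0) (var 1) (var 2) (var 5) (var 3) (var 4)

open scoped Matrix

/-- The pole, with respect to the conic `z1² = z0·z2`, of the chord joining the points with
parameters `p` and `q`. -/
def chordPole {R : Type*} [CommRing R] (p q : R) : Fin 3 → R := ![2, p + q, 2 * (p * q)]

/-- The polar line of a point with respect to the conic `z1² = z0·z2`. -/
def polarLine {R : Type*} [CommRing R] (x : Fin 3 → R) : Fin 3 → R := ![x 2, -(2 * x 1), x 0]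

/-- The Pascal line of the array with columns `(pᵢ, qᵢ)`, written in terms of the sides of the
triangle formed by the poles of the chords `pᵢqᵢ`. -/
def pascalLine {R : Type*} [CommRing R] (p1 q1 p2 q2 p3 q3 : R) : Fin 3 → R :=
  (p1 - q1) • (chordPole p2 q2 ⨯₃ chordPole p3 q3) +
  (p2 - q2) • (chordPole p3 q3 ⨯₃ chordPole p1 q1) +
  (p3 - q3) • (chordPole p1 q1 ⨯₃ chordPole p2 q2)

/-- The determinant of the poles of three chords. -/
def poleDet {R : Type*} [CommRing R] (p1 q1 p2 q2 p3 q3 : R) : R :=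
  chordPole p1 q1 ⬝ᵥ (chordPole p2 q2 ⨯₃ chordPole p3 q3)

/-- The scalar that relates the side of the pole triangle constructed from three Pascal lines
to the cross product of the two poles on it. -/
def gramForm {R : Type*} [CommRing R] (p1 q1 p2 q2 p3 q3 : R) : R :=
  (p2 - q2) * (chordPole p1 q1 ⬝ᵥ polarLine (chordPole p3 q3)) -
  (p1 - q1) * (chordPole p2 q2 ⬝ᵥ polarLine (chordPole p3 q3)) -
  (p3 - q3) * (chordPole p1 q1 ⬝ᵥ polarLine (chordPole p2 q2)) -
  2 * ((p1 - q1) * (p2 - q2) * (p3 - q3))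

section Identities

variable {R S : Type*} [CommRing R] [CommRing S]

theorem chordPole_comm (p q : R) : chordPole p q = chordPole q p := by
  simp [chordPole, add_comm, mul_comm]

theorem map_poleDet (f : R →+* S) (p1 q1 p2 q2 p3 q3 : R) :
    f (poleDet p1 q1 p2 q2 p3 q3) = poleDet (f p1) (f q1) (f p2) (f q2) (f p3) (f q3) := by
  simp [poleDet, chordPole, cross_apply, dotProduct, Fin.sum_univ_three,
    map_ofNat f 2]

theorem map_gramForm (f : R →+* S) (p1 q1 p2 q2 p3 q3 : R) :
    f (gramForm p1 q1 p2 q2 p3 q3) = gramForm (f p1) (f q1) (f p2) (f q2) (f p3) (f q3) := by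
  simp [gramForm, chordPole, polarLine, dotProduct, Fin.sum_univ_three,
    map_ofNat f 2]

theorem map_pascalLine_zero (f : R →+* S) (p1 q1 p2 q2 p3 q3 : R) :
    f (pascalLine p1 q1 p2 q2 p3 q3 0) =
      pascalLine (f p1) (f q1) (f p2) (f q2) (f p3) (f q3) 0 := by
  simp [pascalLine, chordPole, cross_apply, map_ofNat f 2]

theorem pascalLine_rotate (p1 q1 p2 q2 p3 q3 : R) :
    pascalLine p2 q2 p3 q3 p1 q1 = pascalLine p1 q1 p2 q2 p3 q3 := by
  simp only [pascalLine]
  abel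

theorem pascalLine_swap_columns (p1 q1 p2 q2 p3 q3 : R) :
    pascalLine p1 q1 p3 q3 p2 q2 = -pascalLine p1 q1 p2 q2 p3 q3 := by
  ext i
  fin_cases i <;> simp [pascalLine, chordPole, cross_apply] <;> ring

theorem pascalLine_swap_rows (p1 q1 p2 q2 p3 q3 : R) :
    pascalLine q1 p1 q2 p2 q3 p3 = -pascalLine p1 q1 p2 q2 p3 q3 := by
  ext i
  fin_cases i <;> simp [pascalLine, chordPole, cross_apply] <;> ring

theorem pascalLine_cross_pascalLine (p1 q1 p2 q2 p3 q3 : R) :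
    pascalLine p1 q1 p2 q2 p3 q3 ⨯₃ pascalLine p1 q1 p2 q2 q3 p3 =
      (-2 * (p3 - q3) * poleDet p1 q1 p2 q2 p3 q3) •
        ((p2 - q2) • chordPole p1 q1 - (p1 - q1) • chordPole p2 q2) := by
  ext i
  fin_cases i <;>
    simp [pascalLine, poleDet, chordPole, cross_apply, dotProduct, Fin.sum_univ_three] <;> ring

theorem side_poleTriangle (p1 q1 p2 q2 p3 q3 : R) :
    ((p2 - q2) • chordPole p1 q1 - (p1 - q1) • chordPole p2 q2) ⨯₃
      (pascalLine p1 q1 q2 p2 q3 p3 ⨯₃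
        polarLine ((p2 - q2) • chordPole p1 q1 - (p1 - q1) • chordPole p2 q2)) =
      (-2 * (p1 - q1) * (p2 - q2) * gramForm p1 q1 p2 q2 p3 q3) •
        (chordPole p1 q1 ⨯₃ chordPole p2 q2) := by
  ext i
  fin_cases i <;>
    simp [pascalLine, gramForm, polarLine, chordPole, cross_apply, dotProduct,
      Fin.sum_univ_three] <;> ring

theorem cross_sides_poleTriangle (p1 q1 p2 q2 p3 q3 : R) :
    (chordPole p3 q3 ⨯₃ chordPole p1 q1) ⨯₃ (chordPole p1 q1 ⨯₃ chordPole p2 q2) =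
      poleDet p1 q1 p2 q2 p3 q3 • chordPole p1 q1 := by
  ext i
  fin_cases i <;>
    simp [poleDet, chordPole, cross_apply, dotProduct, Fin.sum_univ_three] <;> ring

theorem chordPole_dotProduct_pascalLine (p1 q1 p2 q2 p3 q3 : R) :
    chordPole p1 q1 ⬝ᵥ pascalLine p1 q1 p2 q2 p3 q3 =
      (p1 - q1) * poleDet p1 q1 p2 q2 p3 q3 := by
  simp [pascalLine, poleDet, chordPole, cross_apply, dotProduct, Fin.sum_univ_three]
  ring

theorem poleDet_rotate (p1 q1 p2 q2 p3 q3 : R) :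
    poleDet p2 q2 p3 q3 p1 q1 = poleDet p1 q1 p2 q2 p3 q3 := by
  simp [poleDet, chordPole, cross_apply, dotProduct, Fin.sum_univ_three]
  ring

theorem poleDet_swap (p1 q1 p2 q2 p3 q3 : R) :
    poleDet p1 q1 p3 q3 p2 q2 = -poleDet p1 q1 p2 q2 p3 q3 := by
  simp [poleDet, chordPole, cross_apply, dotProduct, Fin.sum_univ_three]
  ring

end Identities

/-- A vector is projectively rational over a subfield if a nonzero multiple of it has all its
coordinates in the subfield. -/
def ProjRational {K : Type*} [Field K] (F : Subfield K) (v : Fin 3 → K) : Prop :=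
  ∃ c : K, c ≠ 0 ∧ ∀ i, c * v i ∈ F

namespace ProjRational

variable {K : Type*} [Field K] {F : Subfield K} {u v : Fin 3 → K}

theorem crossProduct (hu : ProjRational F u) (hv : ProjRational F v) :
    ProjRational F (u ⨯₃ v) := by
  obtain ⟨c, hc, hu⟩ := hu
  obtain ⟨d, hd, hv⟩ := hv
  refine ⟨c * d, mul_ne_zero hc hd, fun i => ?_⟩
  have key : ∀ i j, c * d * (u i * v j - u j * v i) ∈ F := fun i j => by
    have : c * d * (u i * v j - u j * v i) =
        c * u i * (d * v j) - c * u j * (d * v i) := by ring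
    rw [this]
    exact sub_mem (mul_mem (hu i) (hv j)) (mul_mem (hu j) (hv i))
  fin_cases i <;> simpa [cross_apply] using key _ _

theorem polarLine (hu : ProjRational F u) : ProjRational F (polarLine u) := by
  obtain ⟨c, hc, hu⟩ := hu
  refine ⟨c, hc, fun i => ?_⟩
  have h1 : c * -(2 * u 1) ∈ F := by
    rw [show c * -(2 * u 1) = -(c * u 1 + c * u 1) by ring]
    exact neg_mem (add_mem (hu 1) (hu 1))
  fin_cases i
  · simpa [_root_.polarLine] using hu 2
  · simpa [_root_.polarLine] using h1
  · simpa [_root_.polarLine] using hu 0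

theorem of_smul {k : K} (hk : k ≠ 0) (h : ProjRational F (k • u)) : ProjRational F u := by
  obtain ⟨c, hc, hu⟩ := h
  exact ⟨c * k, mul_ne_zero hc hk, fun i => by simpa [mul_assoc] using hu i⟩

theorem neg (h : ProjRational F u) : ProjRational F (-u) := by
  obtain ⟨c, hc, hu⟩ := h
  exact ⟨c, hc, fun i => by simpa using neg_mem (hu i)⟩

theorem of_div_mem (h0 : u 0 ≠ 0) (h1 : u 1 / u 0 ∈ F) (h2 : u 2 / u 0 ∈ F) :
    ProjRational F u := by
  refine ⟨(u 0)⁻¹, inv_ne_zero h0, fun i => ?_⟩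
  fin_cases i
  · simp [h0, one_mem]
  · simpa [div_eq_inv_mul] using h1
  · simpa [div_eq_inv_mul] using h2

theorem chordPole_mem [CharZero K] {p q : K} (h : ProjRational F (chordPole p q)) :
    p + q ∈ F ∧ p * q ∈ F := by
  obtain ⟨c, hc, h⟩ := h
  have h0 : c * 2 ∈ F := h 0
  have h1 : c * (p + q) ∈ F := h 1
  have h2 : c * (2 * (p * q)) ∈ F := h 2
  have two : (2 : K) ∈ F := ofNat_mem F 2
  constructor
  · have := mul_mem (div_mem h1 h0) two
    rwa [show c * (p + q) / (c * 2) * 2 = p + q by field_simp] at this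
  · have := div_mem h2 h0
    rwa [show c * (2 * (p * q)) / (c * 2) = p * q by field_simp] at this

theorem side_poleTriangle [CharZero K] {p1 q1 p2 q2 p3 q3 : K}
    (h1 : ProjRational F (pascalLine p1 q1 p2 q2 p3 q3))
    (h2 : ProjRational F (pascalLine p1 q1 p2 q2 q3 p3))
    (h3 : ProjRational F (pascalLine p1 q1 q2 p2 q3 p3))
    (hp1 : p1 ≠ q1) (hp2 : p2 ≠ q2) (hp3 : p3 ≠ q3)
    (hdet : poleDet p1 q1 p2 q2 p3 q3 ≠ 0) (hgram : gramForm p1 q1 p2 q2 p3 q3 ≠ 0) :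
    ProjRational F (chordPole p1 q1 ⨯₃ chordPole p2 q2) := by
  have two : (-2 : K) ≠ 0 := by norm_num
  have hX := h1.crossProduct h2
  rw [pascalLine_cross_pascalLine] at hX
  replace hX := hX.of_smul (mul_ne_zero (mul_ne_zero two (sub_ne_zero.2 hp3)) hdet)
  have hC := hX.crossProduct (h3.crossProduct hX.polarLine)
  rw [_root_.side_poleTriangle] at hC
  exact hC.of_smul
    (mul_ne_zero (mul_ne_zero (mul_ne_zero two (sub_ne_zero.2 hp1)) (sub_ne_zero.2 hp2)) hgram)

end ProjRational

section Recovery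

variable {K : Type*} [Field K] [CharZero K] {F : Subfield K} {p1 q1 p2 q2 p3 q3 : K}

/-- The pole triangle of the three chords is rational over any field of definition of the three
Pascal lines, and so are the ratios of the parameter differences of the chords. -/
theorem symmetric_functions_mem
    (h1 : ProjRational F (pascalLine p1 q1 p2 q2 p3 q3))
    (h2 : ProjRational F (pascalLine p1 q1 q2 p2 q3 p3))
    (h3 : ProjRational F (pascalLine p1 q1 p2 q2 q3 p3))
    (hp1 : p1 ≠ q1) (hp2 : p2 ≠ q2) (hp3 : p3 ≠ q3)
    (hdet : poleDet p1 q1 p2 q2 p3 q3 ≠ 0)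
    (hgram12 : gramForm p1 q1 p2 q2 p3 q3 ≠ 0)
    (hgram23 : gramForm p2 q2 p3 q3 q1 p1 ≠ 0)
    (hgram13 : gramForm p1 q1 q3 p3 q2 p2 ≠ 0) :
    (p1 + q1 ∈ F ∧ p1 * q1 ∈ F) ∧ p2 + q2 ∈ F ∧ p3 + q3 ∈ F ∧
      (p2 - q2) / (p1 - q1) ∈ F ∧ (p3 - q3) / (p1 - q1) ∈ F := by
  have hdet23 := hdet
  rw [← poleDet_rotate] at hdet23
  have hdet31 := hdet23
  rw [← poleDet_rotate] at hdet31
  have side12 : ProjRational F (chordPole p1 q1 ⨯₃ chordPole p2 q2) :=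
    h1.side_poleTriangle h3 h2 hp1 hp2 hp3 hdet hgram12
  have side23 : ProjRational F (chordPole p2 q2 ⨯₃ chordPole p3 q3) := by
    refine ProjRational.side_poleTriangle (p3 := q1) (q3 := p1) ?_ ?_ ?_ hp2 hp3 hp1.symm ?_
      hgram23
    · rw [pascalLine_rotate, ← neg_neg (pascalLine q1 p1 p2 q2 p3 q3), ← pascalLine_swap_rows]
      exact h2.neg
    · rwa [pascalLine_rotate]
    · rwa [pascalLine_rotate]
    · rwa [poleDet, chordPole_comm q1 p1]
  have side31 : ProjRational F (chordPole p3 q3 ⨯₃ chordPole p1 q1) := by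
    rw [← neg_cross, chordPole_comm p3 q3]
    refine ProjRational.neg (ProjRational.side_poleTriangle (p3 := q2) (q3 := p2) ?_ ?_ ?_ hp1
      hp3.symm hp2.symm ?_ hgram13)
    · rw [pascalLine_swap_columns]
      exact h2.neg
    · rw [pascalLine_swap_columns]
      exact h3.neg
    · rw [pascalLine_swap_columns]
      exact h1.neg
    · rw [poleDet_swap, neg_ne_zero, poleDet, chordPole_comm q2 p2, chordPole_comm q3 p3]
      exact hdet
  have pole1 : ProjRational F (chordPole p1 q1) := by
    have := side31.crossProduct side12
    rw [cross_sides_poleTriangle] at this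
    exact this.of_smul hdet
  have pole2 : ProjRational F (chordPole p2 q2) := by
    have := side12.crossProduct side23
    rw [cross_sides_poleTriangle] at this
    exact this.of_smul hdet23
  have pole3 : ProjRational F (chordPole p3 q3) := by
    have := side23.crossProduct side31
    rw [cross_sides_poleTriangle] at this
    exact this.of_smul hdet31
  have mem1 := pole1.chordPole_mem
  have mem2 := pole2.chordPole_mem
  have mem3 := pole3.chordPole_mem
  obtain ⟨c, hc, hl⟩ := h1
  have dot_mem : ∀ p q : K, p + q ∈ F ∧ p * q ∈ F →
      c * (chordPole p q ⬝ᵥ pascalLine p1 q1 p2 q2 p3 q3) ∈ F := by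
    rintro p q ⟨hs, hm⟩
    have two : (2 : K) ∈ F := ofNat_mem F 2
    have : c * (chordPole p q ⬝ᵥ pascalLine p1 q1 p2 q2 p3 q3) =
        2 * (c * pascalLine p1 q1 p2 q2 p3 q3 0) +
          (p + q) * (c * pascalLine p1 q1 p2 q2 p3 q3 1) +
          2 * (p * q) * (c * pascalLine p1 q1 p2 q2 p3 q3 2) := by
      simp only [chordPole, dotProduct, Fin.sum_univ_three, Matrix.cons_val]
      ring
    rw [this]
    exact add_mem (add_mem (mul_mem two (hl 0)) (mul_mem hs (hl 1)))
      (mul_mem (mul_mem two hm) (hl 2))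
  have d1 := dot_mem _ _ mem1
  rw [chordPole_dotProduct_pascalLine] at d1
  have d2 := dot_mem _ _ mem2
  rw [← pascalLine_rotate, chordPole_dotProduct_pascalLine, poleDet_rotate] at d2
  have d3 := dot_mem _ _ mem3
  rw [← pascalLine_rotate, ← pascalLine_rotate, chordPole_dotProduct_pascalLine,
    poleDet_rotate, poleDet_rotate] at d3
  have ratio : ∀ x y : K, c * (x * poleDet p1 q1 p2 q2 p3 q3) /
      (c * (y * poleDet p1 q1 p2 q2 p3 q3)) = x / y := fun x y => by
    rw [mul_div_mul_left _ _ hc, mul_div_mul_right _ _ hdet]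
  refine ⟨mem1, mem2.1, mem3.1, ?_, ?_⟩
  · simpa only [ratio] using div_mem d2 d1
  · simpa only [ratio] using div_mem d3 d1

end Recovery

theorem pascalVec_eq_smul_pascalLine (p1 p2 p3 q1 q2 q3 : RatField) :
    pascalVec p1 p2 p3 q1 q2 q3 =
      ((q2 - p1) * (q1 - p2) * (q3 - p2) * (q2 - p3) * (p2 - q2) / 4) •
        pascalLine p1 q1 p2 q2 p3 q3 := by
  ext i
  fin_cases i <;>
    simp [pascalVec, cross, conicPt, pascalLine, chordPole, cross_apply] <;> ring

theorem pascalVec_swap_rows (p1 p2 p3 q1 q2 q3 : RatField) :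
    pascalVec q1 q2 q3 p1 p2 p3 = pascalVec p1 p2 p3 q1 q2 q3 := by
  rw [pascalVec_eq_smul_pascalLine, pascalVec_eq_smul_pascalLine, pascalLine_swap_rows,
    smul_neg, ← neg_smul]
  congr 1
  ring

theorem var_injective : Function.Injective var :=
  (IsFractionRing.injective (MvPolynomial (Fin 6) ℚ) RatField).comp
    (MvPolynomial.X_injective (R := ℚ))

theorem algebraMap_ne_zero_of_eval (x : Fin 6 → ℚ) {P : MvPolynomial (Fin 6) ℚ}
    (h : MvPolynomial.eval x P ≠ 0) :
    algebraMap (MvPolynomial (Fin 6) ℚ) RatField P ≠ 0 := by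
  refine (map_ne_zero_iff _ (IsFractionRing.injective _ _)).2 ?_
  rintro rfl
  exact h (map_zero _)

theorem poleDet_var_ne_zero (x : Fin 6 → ℚ) {i j k l m n : Fin 6}
    (h : poleDet (x i) (x j) (x k) (x l) (x m) (x n) ≠ 0) :
    poleDet (var i) (var j) (var k) (var l) (var m) (var n) ≠ 0 := by
  simp only [var, ← map_poleDet]
  apply algebraMap_ne_zero_of_eval x
  simpa only [map_poleDet, MvPolynomial.eval_X] using h

theorem gramForm_var_ne_zero (x : Fin 6 → ℚ) {i j k l m n : Fin 6}
    (h : gramForm (x i) (x j) (x k) (x l) (x m) (x n) ≠ 0) :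
    gramForm (var i) (var j) (var k) (var l) (var m) (var n) ≠ 0 := by
  simp only [var, ← map_gramForm]
  apply algebraMap_ne_zero_of_eval x
  simpa only [map_gramForm, MvPolynomial.eval_X] using h

theorem pascalLine_var_zero_ne_zero (x : Fin 6 → ℚ) {i j k l m n : Fin 6}
    (h : pascalLine (x i) (x j) (x k) (x l) (x m) (x n) 0 ≠ 0) :
    pascalLine (var i) (var j) (var k) (var l) (var m) (var n) 0 ≠ 0 := by
  simp only [var, ← map_pascalLine_zero]
  apply algebraMap_ne_zero_of_eval x
  simpa only [map_pascalLine_zero, MvPolynomial.eval_X] using h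

theorem ProjRational.pascalLine_of_coord_mem {F : Subfield RatField}
    {p1 p2 p3 q1 q2 q3 : RatField}
    (hs : sCoord (pascalVec p1 p2 p3 q1 q2 q3) ∈ F)
    (ht : tCoord (pascalVec p1 p2 p3 q1 q2 q3) ∈ F)
    (h12 : p1 ≠ q2) (h21 : p2 ≠ q1) (h23 : p2 ≠ q3) (h32 : p3 ≠ q2) (h22 : p2 ≠ q2)
    (h0 : pascalLine p1 q1 p2 q2 p3 q3 0 ≠ 0) :
    ProjRational F (pascalLine p1 q1 p2 q2 p3 q3) := by
  have hk : (q2 - p1) * (q1 - p2) * (q3 - p2) * (q2 - p3) * (p2 - q2) / 4 ≠ 0 := by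
    simp [sub_eq_zero, h12.symm, h21.symm, h23.symm, h32.symm, h22]
  have := ProjRational.of_div_mem (u := pascalVec p1 p2 p3 q1 q2 q3) (by
    rw [pascalVec_eq_smul_pascalLine]
    exact mul_ne_zero hk h0) hs ht
  rw [pascalVec_eq_smul_pascalLine] at this
  exact this.of_smul hk

/-- The subfield generated by the line coordinates of the three Pascal lines. -/
abbrev pascalField : Subfield RatField :=
  Subfield.closure
    {sCoord line1, tCoord line1, sCoord line2, tCoord line2, sCoord line3, tCoord line3}

theorem symmetric_functions_mem_pascalField :
    (var 0 + var 4 ∈ pascalField ∧ var 0 * var 4 ∈ pascalField) ∧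
      var 3 + var 2 ∈ pascalField ∧ var 1 + var 5 ∈ pascalField ∧
      (var 3 - var 2) / (var 0 - var 4) ∈ pascalField ∧
      (var 1 - var 5) / (var 0 - var 4) ∈ pascalField := by
  have gen : ∀ {x}, x ∈ ({sCoord line1, tCoord line1, sCoord line2, tCoord line2,
      sCoord line3, tCoord line3} : Set RatField) → x ∈ pascalField :=
    fun h => Subfield.subset_closure h
  have hne : ∀ {i j}, i ≠ j → var i ≠ var j := fun h => var_injective.ne h
  have h1 : ProjRational pascalField
      (pascalLine (var 0) (var 4) (var 3) (var 2) (var 1) (var 5)) := by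
    refine .pascalLine_of_coord_mem (gen (x := sCoord line1) (by simp))
      (gen (x := tCoord line1) (by simp)) ?_ ?_ ?_ ?_ ?_
      (pascalLine_var_zero_ne_zero ![0, 1, 3, 7, 12, 20] ?_)
    on_goal 6 => simp [pascalLine, chordPole, cross_apply]; norm_num
    all_goals exact hne (by decide)
  have h2 : ProjRational pascalField
      (pascalLine (var 0) (var 4) (var 2) (var 3) (var 5) (var 1)) := by
    refine .pascalLine_of_coord_mem (gen (x := sCoord line2) (by simp))
      (gen (x := tCoord line2) (by simp)) ?_ ?_ ?_ ?_ ?_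
      (pascalLine_var_zero_ne_zero ![0, 1, 3, 7, 12, 20] ?_)
    on_goal 6 => simp [pascalLine, chordPole, cross_apply]; norm_num
    all_goals exact hne (by decide)
  have h3 : ProjRational pascalField
      (pascalLine (var 0) (var 4) (var 3) (var 2) (var 5) (var 1)) := by
    refine .pascalLine_of_coord_mem (gen (x := sCoord line3) (by simp))
      (gen (x := tCoord line3) (by simp)) ?_ ?_ ?_ ?_ ?_
      (pascalLine_var_zero_ne_zero ![0, 1, 3, 7, 12, 20] ?_)
    on_goal 6 => simp [pascalLine, chordPole, cross_apply]; norm_num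
    all_goals exact hne (by decide)
  refine symmetric_functions_mem h1 h2 h3 (hne (by decide)) (hne (by decide)) (hne (by decide))
    (poleDet_var_ne_zero ![0, 1, 3, 7, 12, 20] ?_)
    (gramForm_var_ne_zero ![0, 1, 3, 7, 12, 20] ?_)
    (gramForm_var_ne_zero ![0, 1, 3, 7, 12, 20] ?_)
    (gramForm_var_ne_zero ![0, 1, 3, 7, 12, 20] ?_) <;>
  · simp [poleDet, gramForm, polarLine, chordPole, cross_apply, dotProduct, Fin.sum_univ_three]
    norm_num

theorem adjoin_var_zero_eq_top :
    IntermediateField.adjoin pascalField {var 0} = ⊤ := by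
  set E := IntermediateField.adjoin pascalField {var 0}
  obtain ⟨⟨h04, -⟩, h32, h15, r32, r15⟩ := symmetric_functions_mem_pascalField
  have base : ∀ {x}, x ∈ pascalField → x ∈ E := fun {x} h => E.algebraMap_mem ⟨x, h⟩
  have m0 : var 0 ∈ E := IntermediateField.mem_adjoin_simple_self _ _
  have m4 : var 4 ∈ E := by simpa using sub_mem (base h04) m0
  have half : ∀ {i j : Fin 6}, var i + var j ∈ pascalField →
      (var i - var j) / (var 0 - var 4) ∈ pascalField → var i ∈ E ∧ var j ∈ E := by
    intro i j hs hr
    have hd : var i - var j ∈ E := by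
      have := mul_mem (base hr) (sub_mem m0 m4)
      rwa [div_mul_cancel₀ _ (sub_ne_zero.2 (var_injective.ne (by decide)))] at this
    have hi : var i ∈ E := by
      have := div_mem (add_mem (base hs) hd) (ofNat_mem E 2)
      rwa [show (var i + var j + (var i - var j)) / (OfNat.ofNat 2) = var i by ring] at this
    exact ⟨hi, by simpa using sub_mem (base hs) hi⟩
  have hvar : ∀ i, var i ∈ E := by
    intro i
    fin_cases i
    exacts [m0, (half h15 r15).1, (half h32 r32).2, (half h32 r32).1, m4, (half h15 r15).2]
  have hpoly : ∀ P : MvPolynomial (Fin 6) ℚ, algebraMap _ RatField P ∈ E := by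
    intro P
    induction P using MvPolynomial.induction_on with
    | C r =>
      rw [← MvPolynomial.algebraMap_eq, ← IsScalarTower.algebraMap_apply, eq_ratCast]
      exact SubfieldClass.ratCast_mem E r
    | add P Q hP hQ => simpa using add_mem hP hQ
    | mul_X P i hP => simpa [var] using mul_mem hP (hvar i)
  refine eq_top_iff.2 fun x _ => ?_
  obtain ⟨P, Q, -, rfl⟩ := IsFractionRing.div_surjective (A := MvPolynomial (Fin 6) ℚ) x
  exact div_mem (hpoly P) (hpoly Q)

/-- The permutation of the variables that exchanges the two rows of all three arrays. -/
def rowSwap : Equiv.Perm (Fin 6) := Equiv.swap 0 4 * Equiv.swap 2 3 * Equiv.swap 1 5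

/-- The automorphism of `K` induced by `rowSwap`. -/
def rowSwapHom : RatField ≃+* RatField :=
  IsFractionRing.ringEquivOfRingEquiv (MvPolynomial.renameEquiv ℚ rowSwap).toRingEquiv

theorem rowSwapHom_var (i : Fin 6) : rowSwapHom (var i) = var (rowSwap i) := by
  simp [rowSwapHom, var]

theorem map_pascalVec (f : RatField ≃+* RatField) (p1 p2 p3 q1 q2 q3 : RatField) (i : Fin 3) :
    f (pascalVec p1 p2 p3 q1 q2 q3 i) =
      pascalVec (f p1) (f p2) (f p3) (f q1) (f q2) (f q3) i := by
  fin_cases i <;> simp [pascalVec, cross, conicPt]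

theorem rowSwapHom_pascalVec {i j k l m n : Fin 6} (hi : rowSwap i = l) (hj : rowSwap j = m)
    (hk : rowSwap k = n) (hl : rowSwap l = i) (hm : rowSwap m = j) (hn : rowSwap n = k)
    (r : Fin 3) :
    rowSwapHom (pascalVec (var i) (var j) (var k) (var l) (var m) (var n) r) =
      pascalVec (var i) (var j) (var k) (var l) (var m) (var n) r := by
  rw [map_pascalVec]
  simp only [rowSwapHom_var, hi, hj, hk, hl, hm, hn]
  rw [pascalVec_swap_rows]

theorem rowSwapHom_eq_self {x : RatField} (hx : x ∈ pascalField) : rowSwapHom x = x := by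
  suffices pascalField ≤ rowSwapHom.toRingHom.eqLocusField (RingHom.id RatField) from this hx
  refine Subfield.closure_le.2 ?_
  have e1 : ∀ r, rowSwapHom (line1 r) = line1 r := rowSwapHom_pascalVec
    (by decide) (by decide) (by decide) (by decide) (by decide) (by decide)
  have e2 : ∀ r, rowSwapHom (line2 r) = line2 r := rowSwapHom_pascalVec
    (by decide) (by decide) (by decide) (by decide) (by decide) (by decide)
  have e3 : ∀ r, rowSwapHom (line3 r) = line3 r := rowSwapHom_pascalVec
    (by decide) (by decide) (by decide) (by decide) (by decide) (by decide)
  rintro _ (rfl | rfl | rfl | rfl | rfl | rfl) <;>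
    change rowSwapHom _ = _ <;> simp [sCoord, tCoord, e1, e2, e3]

theorem var_zero_notMem_pascalField : var 0 ∉ pascalField := fun h => by
  have := rowSwapHom_eq_self h
  rw [rowSwapHom_var] at this
  exact absurd (var_injective this) (by decide)

/-- The field extension `K = ℚ(a,…,f)` over its subfield `ℚ(s₁, t₁, s₂, t₂, s₃, t₃)`
generated by the line coordinates of the three Pascal lines `ℓ₁, ℓ₂, ℓ₃` has degree
exactly `2`. -/
theorem pascal_stmt_3 :
    Module.finrank
      (Subfield.closure
        {sCoord line1, tCoord line1, sCoord line2, tCoord line2,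
          sCoord line3, tCoord line3} : Subfield RatField) RatField = 2 := by
  obtain ⟨⟨hs, hm⟩, -⟩ := symmetric_functions_mem_pascalField
  set P : Polynomial pascalField := .X ^ 2 - .C ⟨_, hs⟩ * .X + .C ⟨_, hm⟩ with hP
  have hdeg : P.natDegree = 2 := by
    rw [hP]
    compute_degree!
  have hmonic : P.Monic := by
    rw [hP]
    monicity!
  have hroot : Polynomial.aeval (var 0) P = 0 := by
    simp only [hP, map_add, map_sub, map_mul, map_pow, Polynomial.aeval_X, Polynomial.aeval_C]
    change var 0 ^ 2 - (var 0 + var 4) * var 0 + var 0 * var 4 = 0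
    ring
  have hint : IsIntegral pascalField (var 0) := ⟨P, hmonic, hroot⟩
  have hle : (minpoly pascalField (var 0)).natDegree ≤ 2 :=
    hdeg ▸ Polynomial.natDegree_le_of_dvd (minpoly.dvd _ _ hroot) hmonic.ne_zero
  have hpos := minpoly.natDegree_pos hint
  have hne : (minpoly pascalField (var 0)).natDegree ≠ 1 := fun h => by
    obtain ⟨y, hy⟩ := minpoly.natDegree_eq_one_iff.1 h
    exact var_zero_notMem_pascalField (hy ▸ y.2)
  rw [← IntermediateField.finrank_top', ← adjoin_var_zero_eq_top,
    IntermediateField.adjoin.finrank hint]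
  omega

end
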